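/- arXiv:1711.01805 — 3 statements merged into one kernel-verified Lean document; each statement's English description precedes it below -/
import Mathlib

section
/- Let λ₁, λ₂ ∈ (−1, 1) and α₁, α₂ > 0. Then the operators B(λ₁, α₁) and B(λ₂, α₂) on ℓ²(ℤ,ℂ) ⊕ ℓ²(ℤ,ℂ) are unitarily equivalent if and only if λ₁ = λ₂ and α₁ = α₂. -/
noncomputable section

open ContinuousLinearMap

/-- The Hilbert space `ℓ²(ℤ, ℂ)`. -/
abbrev H : Type := lp (fun _ : ℤ => ℂ) 2

/-- The standard orthonormal basis vectors of `ℓ²(ℤ, ℂ)`. -/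
def e (n : ℤ) : H := lp.single 2 n 1

/-- The `2 × 2` upper-triangular block operator `[[T₁, S], [0, T₂]]` on the Hilbert space
direct sum `E ⊕ E = WithLp 2 (E × E)`. -/
def blockOp {E : Type*} [NormedAddCommGroup E] [NormedSpace ℂ E]
    (T₁ S T₂ : E →L[ℂ] E) : WithLp 2 (E × E) →L[ℂ] WithLp 2 (E × E) :=
  ((WithLp.prodContinuousLinearEquiv 2 ℂ E E).symm :
      E × E →L[ℂ] WithLp 2 (E × E)) ∘L
    ((((T₁ ∘L fst ℂ E E) + (S ∘L snd ℂ E E)).prod (T₂ ∘L snd ℂ E E)) ∘L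
      ((WithLp.prodContinuousLinearEquiv 2 ℂ E E) :
        WithLp 2 (E × E) →L[ℂ] E × E))

/-- Unitary equivalence of bounded operators on (possibly different) complex Hilbert spaces:
there is a unitary (= surjective linear isometry) `U` with `U A U⁻¹ = B`. -/
def UnitarilyEquiv {E F : Type*} [NormedAddCommGroup E] [NormedSpace ℂ E]
    [NormedAddCommGroup F] [NormedSpace ℂ F] (A : E →L[ℂ] E) (B : F →L[ℂ] F) : Prop :=
  ∃ U : E ≃ₗᵢ[ℂ] F, ∀ x, U (A x) = B (U x)

/-- The Möbius transform `e^{iθ} (T - c·1)(1 - c̄·T)⁻¹` of an operator. -/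
def mobius {E : Type*} [NormedAddCommGroup E] [NormedSpace ℂ E] [CompleteSpace E]
    (θ : ℝ) (c : ℂ) (T : E →L[ℂ] E) : E →L[ℂ] E :=
  Complex.exp (θ * Complex.I) •
    ((T - c • (1 : E →L[ℂ] E)) * Ring.inverse (1 - (starRingEnd ℂ c) • T))

/-- A bounded operator on a complex Hilbert space is homogeneous if its spectrum lies in the
closed unit disc and all its Möbius transforms are unitarily equivalent to it. -/
def Homogeneous {E : Type*} [NormedAddCommGroup E] [NormedSpace ℂ E] [CompleteSpace E]
    (T : E →L[ℂ] E) : Prop :=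
  spectrum ℂ T ⊆ Metric.closedBall 0 1 ∧
    ∀ (θ : ℝ) (c : ℂ), ‖c‖ < 1 →
      IsUnit (1 - (starRingEnd ℂ c) • T) ∧ UnitarilyEquiv (mobius θ c T) T

/-- A bounded operator is irreducible if the only closed subspaces invariant under both the
operator and its adjoint are `{0}` and the whole space. -/
def IrreducibleOp {E : Type*} [NormedAddCommGroup E] [InnerProductSpace ℂ E] [CompleteSpace E]
    (T : E →L[ℂ] E) : Prop :=
  ∀ M : Submodule ℂ E, IsClosed (M : Set E) → (∀ x ∈ M, T x ∈ M) →
    (∀ x ∈ M, ContinuousLinearMap.adjoint T x ∈ M) → M = ⊥ ∨ M = ⊤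

/-- Weight sequence of the shift `B_{λ, ia}`. -/
def wB (l a : ℝ) (n : ℤ) : ℂ :=
  ((n : ℂ) + (1 + (l : ℂ)) / 2 + Complex.I * (a : ℂ)) /
    ((n : ℂ) + (1 + (l : ℂ)) / 2 - Complex.I * (a : ℂ))

/-- Weight sequence of the shift `T(a, b)`. -/
def wT (a b : ℝ) (n : ℤ) : ℂ := (Real.sqrt (((n : ℝ) + a) / ((n : ℝ) + b)) : ℂ)

/-- Weight sequence of the shift `S[λ]`. -/
def wS (l : ℝ) (n : ℤ) : ℂ := ((l : ℂ) + 2 * (n : ℂ) + 1)⁻¹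

open scoped InnerProductSpace

/-- A bounded operator acting on the basis as a weighted shift acts so on coordinates. -/
theorem weightedShift_apply {S : H →L[ℂ] H} {w : ℤ → ℂ}
    (hS : ∀ n, S (e n) = w n • e (n + 1)) (x : H) (n : ℤ) :
    S x (n + 1) = w n * x n := by
  have h1 : HasSum (fun m : ℤ => lp.single 2 m (x m) : ℤ → H) x :=
    lp.hasSum_single (by norm_num) x
  have h2 := (h1.mapL S).mapL (lp.evalCLM ℂ (fun _ : ℤ => ℂ) 2 (n + 1))
  have hterm : ∀ m : ℤ, S (lp.single 2 m (x m) : H) (n + 1)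
      = if m = n then w n * x n else 0 := by
    intro m
    have he : (lp.single 2 m (x m) : H) = x m • e m := by
      rw [e, ← lp.single_smul, smul_eq_mul, mul_one]
    rw [he, map_smul, hS]
    simp only [lp.coeFn_smul, Pi.smul_apply, smul_eq_mul, e, lp.single_apply]
    by_cases hm : m = n
    · subst hm; simp [mul_comm]
    · simp [hm, Ne.symm hm]
  have h3 : HasSum (fun m : ℤ => if m = n then w n * x n else 0) (S x (n + 1)) := by
    simp only [← hterm]
    exact h2
  exact h3.unique (hasSum_ite_eq n (w n * x n))

/-- The operator `T` maps the `n`-th coordinate pair to the `(n + 1)`-st one through the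
matrix `[[1, a n], [0, 1]]`. -/
def IsBlockShift (T : WithLp 2 (H × H) →L[ℂ] WithLp 2 (H × H)) (a : ℤ → ℝ) : Prop :=
  ∀ y n, (T y).fst (n + 1) = y.fst n + a n * y.snd n ∧ (T y).snd (n + 1) = y.snd n

theorem isBlockShift_blockOp {B₀ S : H →L[ℂ] H} {l α : ℝ}
    (hB₀ : ∀ n : ℤ, B₀ (e n) = e (n + 1)) (hS : ∀ n : ℤ, S (e n) = wS l n • e (n + 1)) :
    IsBlockShift (blockOp B₀ ((α : ℂ) • S) B₀) (fun n => α * (l + 2 * n + 1)⁻¹) := by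
  have hB := weightedShift_apply (S := B₀) (w := fun _ => 1) (by simpa using hB₀)
  intro y n
  have h1 : (blockOp B₀ ((α : ℂ) • S) B₀ y).fst = B₀ y.fst + (α : ℂ) • S y.snd := rfl
  have h2 : (blockOp B₀ ((α : ℂ) • S) B₀ y).snd = B₀ y.snd := rfl
  rw [h1, h2]
  simp only [lp.coeFn_add, lp.coeFn_smul, Pi.add_apply, Pi.smul_apply, smul_eq_mul, hB,
    weightedShift_apply hS, wS]
  constructor
  · push_cast; ring
  · ring

theorem pair_ext {x y : WithLp 2 (H × H)} (h : ∀ n, x.fst n = y.fst n ∧ x.snd n = y.snd n) :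
    x = y :=
  WithLp.ofLp_injective 2 (Prod.ext (lp.ext (funext fun n => (h n).1))
    (lp.ext (funext fun n => (h n).2)))

theorem inner_toLp_e (u v : ℂ) (n : ℤ) (y : WithLp 2 (H × H)) :
    ⟪WithLp.toLp 2 (u • e n, v • e n), y⟫_ℂ
      = starRingEnd ℂ u * y.fst n + starRingEnd ℂ v * y.snd n := by
  rw [WithLp.prod_inner_apply]
  simp only [inner_smul_left, e, lp.inner_single_left]
  simp

namespace IsBlockShift

variable {T : WithLp 2 (H × H) →L[ℂ] WithLp 2 (H × H)} {a : ℤ → ℝ}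

theorem apply_toLp_e (hT : IsBlockShift T a) (u v : ℂ) (n : ℤ) :
    T (WithLp.toLp 2 (u • e n, v • e n))
      = WithLp.toLp 2 ((u + a n * v) • e (n + 1), v • e (n + 1)) := by
  refine pair_ext fun m => ?_
  obtain ⟨m, rfl⟩ : ∃ k, m = k + 1 := ⟨m - 1, by ring⟩
  rw [(hT _ m).1, (hT _ m).2]
  by_cases hm : m = n
  · subst hm; simp [e]
  · simp [e, hm]

theorem adjoint_comp_self_apply (hT : IsBlockShift T a) (y : WithLp 2 (H × H)) (n : ℤ) :
    (adjoint T (T y)).fst n = y.fst n + a n * y.snd n ∧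
      (adjoint T (T y)).snd n = a n * y.fst n + (1 + a n ^ 2) * y.snd n := by
  have key : ∀ u v : ℂ, starRingEnd ℂ u * (adjoint T (T y)).fst n
      + starRingEnd ℂ v * (adjoint T (T y)).snd n
      = starRingEnd ℂ (u + a n * v) * (y.fst n + a n * y.snd n)
        + starRingEnd ℂ v * y.snd n := by
    intro u v
    rw [← inner_toLp_e, adjoint_inner_right, hT.apply_toLp_e, inner_toLp_e, (hT y n).1,
      (hT y n).2]
  constructor
  · simpa using key 1 0
  · have h := key 0 1
    simp only [map_zero, map_one, zero_mul, one_mul, zero_add, mul_one,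
      Complex.conj_ofReal] at h
    rw [h]; ring

/-- The Cayley–Hamilton defect of `T* T` with respect to the number `2 + c`. -/
theorem defect_apply (hT : IsBlockShift T a) (c : ℂ) (y : WithLp 2 (H × H)) (n : ℤ) :
    let M := adjoint T ∘L T
    (M (M y) - (2 + c) • M y + y).fst n = (a n ^ 2 - c) * (y.fst n + a n * y.snd n) ∧
      (M (M y) - (2 + c) • M y + y).snd n
        = (a n ^ 2 - c) * (a n * y.fst n + (1 + a n ^ 2) * y.snd n) := by
  have h1 := hT.adjoint_comp_self_apply y n
  have h2 := hT.adjoint_comp_self_apply (adjoint T (T y)) n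
  simp only [comp_apply, WithLp.add_fst, WithLp.sub_fst, WithLp.smul_fst, WithLp.add_snd,
    WithLp.sub_snd, WithLp.smul_snd, lp.coeFn_add, lp.coeFn_sub, lp.coeFn_smul, Pi.add_apply,
    Pi.sub_apply, Pi.smul_apply, smul_eq_mul, h1.1, h1.2, h2.1, h2.2]
  constructor <;> ring

theorem defect_eq_zero (hT : IsBlockShift T a) {x : WithLp 2 (H × H)} {n : ℤ}
    (hx : ∀ m, m ≠ n → x.fst m = 0 ∧ x.snd m = 0) :
    let M := adjoint T ∘L T
    M (M x) - (2 + (a n : ℂ) ^ 2) • M x + x = 0 := by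
  refine pair_ext fun m => ?_
  rw [(hT.defect_apply _ x m).1, (hT.defect_apply _ x m).2]
  by_cases hm : m = n
  · subst hm; simp
  · simp [hx m hm]

theorem sq_eq_of_defect_eq_zero (hT : IsBlockShift T a) {y : WithLp 2 (H × H)} {n : ℤ} {c : ℂ}
    (hy : ¬ (y.fst n = 0 ∧ y.snd n = 0))
    (h : (adjoint T ∘L T) ((adjoint T ∘L T) y) - (2 + c) • (adjoint T ∘L T) y + y = 0) :
    (a n : ℂ) ^ 2 = c := by
  by_contra hc
  have h12 := hT.defect_apply c y n
  simp only [h] at h12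
  have h1 : y.fst n + a n * y.snd n = 0 :=
    (mul_eq_zero.1 h12.1.symm).resolve_left (sub_ne_zero.2 hc)
  have h2 : a n * y.fst n + (1 + a n ^ 2) * y.snd n = 0 :=
    (mul_eq_zero.1 h12.2.symm).resolve_left (sub_ne_zero.2 hc)
  have h3 : y.snd n = 0 := by linear_combination h2 - a n * h1
  exact hy ⟨by simpa [h3] using h1, h3⟩

theorem iterate_toLp_e (hT : IsBlockShift T a) (n : ℕ) :
    T^[n] (WithLp.toLp 2 ((1 : ℂ) • e 0, (0 : ℂ) • e 0))
      = WithLp.toLp 2 ((1 : ℂ) • e n, (0 : ℂ) • e n) := by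
  induction n with
  | zero => simp
  | succ n ih =>
    rw [Function.iterate_succ_apply', ih, hT.apply_toLp_e]
    simp

theorem iterate_coord_ne_zero (hT : IsBlockShift T a) {y : WithLp 2 (H × H)} {k : ℤ}
    (hy : ¬ (y.fst k = 0 ∧ y.snd k = 0)) (n : ℕ) :
    ¬ ((T^[n] y).fst (k + n) = 0 ∧ (T^[n] y).snd (k + n) = 0) := by
  induction n with
  | zero => simpa using hy
  | succ n ih =>
    rw [Function.iterate_succ_apply', Nat.cast_succ, ← add_assoc, (hT _ _).1, (hT _ _).2]
    rintro ⟨h1, h2⟩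
    exact ih ⟨by simpa [h2] using h1, h2⟩

end IsBlockShift

theorem map_adjoint_comp_self {E F : Type*} [NormedAddCommGroup E] [InnerProductSpace ℂ E]
    [CompleteSpace E] [NormedAddCommGroup F] [InnerProductSpace ℂ F] [CompleteSpace F]
    {A : E →L[ℂ] E} {B : F →L[ℂ] F} (U : E ≃ₗᵢ[ℂ] F) (hU : ∀ x, U (A x) = B (U x)) (x : E) :
    U ((adjoint A ∘L A) x) = (adjoint B ∘L B) (U x) := by
  refine ext_inner_left ℂ fun z => ?_
  obtain ⟨z, rfl⟩ := U.surjective z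
  simp only [comp_apply]
  rw [U.inner_map_map, adjoint_inner_right, adjoint_inner_right, ← hU, ← hU, U.inner_map_map]

/-- Unitarily equivalent block shifts have, up to a translation, the same squared weights on
the nonnegative half-line. -/
theorem exists_sq_eq_sq_of_unitarilyEquiv {T₁ T₂ : WithLp 2 (H × H) →L[ℂ] WithLp 2 (H × H)}
    {a b : ℤ → ℝ} (h₁ : IsBlockShift T₁ a) (h₂ : IsBlockShift T₂ b)
    (h : UnitarilyEquiv T₁ T₂) : ∃ k : ℤ, ∀ n : ℕ, b (k + n) ^ 2 = a n ^ 2 := by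
  obtain ⟨U, hU⟩ := h
  set x : WithLp 2 (H × H) := WithLp.toLp 2 ((1 : ℂ) • e 0, (0 : ℂ) • e 0) with hxdef
  have hx : x ≠ 0 := fun h0 => by
    have : x.fst 0 = 0 := by rw [h0]; rfl
    simp [hxdef, e] at this
  obtain ⟨k, hk⟩ : ∃ k, ¬ ((U x).fst k = 0 ∧ (U x).snd k = 0) := by
    by_contra! hc
    exact hx (U.map_eq_zero_iff.1 (pair_ext hc))
  refine ⟨k, fun n => ?_⟩
  have hUn : U (T₁^[n] x) = T₂^[n] (U x) := Function.Semiconj.iterate_right hU n x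
  have hd := h₁.defect_eq_zero (x := T₁^[n] x) (n := n) (by
    intro m hm
    rw [hxdef, h₁.iterate_toLp_e]
    simp [e, hm])
  have hUd := congrArg U hd
  simp only [map_add, map_sub, map_smul, map_zero, map_adjoint_comp_self U hU, hUn] at hUd
  exact_mod_cast h₂.sq_eq_of_defect_eq_zero (h₂.iterate_coord_ne_zero hk n) hUd

/-- `B(λ₁, α₁)` and `B(λ₂, α₂)` are unitarily equivalent iff `λ₁ = λ₂` and
`α₁ = α₂`. -/
theorem stmt2 (l₁ l₂ : ℝ) (hl₁ : -1 < l₁ ∧ l₁ < 1) (hl₂ : -1 < l₂ ∧ l₂ < 1)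
    (α₁ α₂ : ℝ) (hα₁ : 0 < α₁) (hα₂ : 0 < α₂)
    (B₀ S₁ S₂ : H →L[ℂ] H)
    (hB₀ : ∀ n : ℤ, B₀ (e n) = e (n + 1))
    (hS₁ : ∀ n : ℤ, S₁ (e n) = wS l₁ n • e (n + 1))
    (hS₂ : ∀ n : ℤ, S₂ (e n) = wS l₂ n • e (n + 1)) :
    UnitarilyEquiv (blockOp B₀ ((α₁ : ℂ) • S₁) B₀) (blockOp B₀ ((α₂ : ℂ) • S₂) B₀) ↔
      l₁ = l₂ ∧ α₁ = α₂ := by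
  constructor
  · intro h
    obtain ⟨k, hk⟩ := exists_sq_eq_sq_of_unitarilyEquiv (isBlockShift_blockOp hB₀ hS₁)
      (isBlockShift_blockOp hB₀ hS₂) h
    have ne_zero : ∀ l : ℝ, -1 < l ∧ l < 1 → ∀ n : ℤ, l + 2 * n + 1 ≠ 0 := by
      intro l hl n h0
      have h1 : (-1 : ℝ) < n := by linarith
      have h2 : (n : ℝ) < 0 := by linarith
      norm_cast at h1 h2
      omega
    have hpoly : ∀ n : ℕ, α₂ ^ 2 * (l₁ + 2 * n + 1) ^ 2
        = α₁ ^ 2 * (l₂ + 2 * (k + n) + 1) ^ 2 := by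
      intro n
      have h1 := ne_zero l₁ hl₁ n
      have h2 := ne_zero l₂ hl₂ (k + n)
      have h3 := hk n
      push_cast at h1 h2 h3
      field_simp at h3
      linear_combination h3
    have p0 := hpoly 0
    have p1 := hpoly 1
    have p2 := hpoly 2
    push_cast at p0 p1 p2
    have hsq : α₁ ^ 2 = α₂ ^ 2 := by linear_combination (-p0 + 2 * p1 - p2) / 8
    have hα : α₁ = α₂ := (pow_left_inj₀ hα₁.le hα₂.le two_ne_zero).1 hsq
    subst hα
    have hl : l₁ = l₂ + 2 * k := by
      have h1 : α₁ ^ 2 * (l₁ - (l₂ + 2 * k)) = 0 := by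
        linear_combination (p1 - p0) / 4
      have := (mul_eq_zero.1 h1).resolve_left (by positivity)
      linarith
    have hk1 : (-1 : ℝ) < k := by linarith [hl₁.1, hl₂.2]
    have hk2 : (k : ℝ) < 1 := by linarith [hl₁.2, hl₂.1]
    norm_cast at hk1 hk2
    obtain rfl : k = 0 := by omega
    exact ⟨by simpa using hl, rfl⟩
  · rintro ⟨rfl, rfl⟩
    have hS : S₁ = S₂ := by
      refine ContinuousLinearMap.ext fun x => lp.ext (funext fun m => ?_)
      obtain ⟨m, rfl⟩ : ∃ k, m = k + 1 := ⟨m - 1, by ring⟩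
      rw [weightedShift_apply hS₁, weightedShift_apply hS₂]
    subst hS
    exact ⟨LinearIsometryEquiv.refl ℂ _, fun _ => rfl⟩
end
end

section
/- Let 0 < a₁ < b₁ < 1, 0 < a₂ < b₂ < 1 and α₁, α₂ > 0. Then the operators T(a₁, b₁, α₁) and T(a₂, b₂, α₂) on ℓ²(ℤ,ℂ) ⊕ ℓ²(ℤ,ℂ) are unitarily equivalent if and only if a₁ = a₂, b₁ = b₂ and α₁ = α₂. -/
noncomputable section

open ContinuousLinearMap

open scoped InnerProductSpace

theorem inner_e_left (n : ℤ) (x : H) : ⟪e n, x⟫_ℂ = x n := by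
  simp [e, lp.inner_single_left]

theorem e_apply (n k : ℤ) : (e n) k = if k = n then 1 else 0 := by
  by_cases h : k = n
  · subst h; simp [e]
  · simp [e, h]

/-- An operator acting on the standard basis as a weighted shift acts on coordinates as one. -/
theorem shift_apply {w : ℤ → ℂ} {T : H →L[ℂ] H} (hT : ∀ n, T (e n) = w n • e (n + 1))
    (x : H) (n : ℤ) : T x (n + 1) = w n * x n := by
  have key : adjoint T (e (n + 1)) = starRingEnd ℂ (w n) • e n := by
    ext k
    rw [← inner_e_left, adjoint_inner_right, hT, inner_smul_left, inner_e_left]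
    by_cases h : k = n
    · subst h; simp [e_apply]
    · have h' : k + 1 ≠ n + 1 := fun h' => h (by linarith)
      simp [e_apply, h, h']
  rw [← inner_e_left, ← adjoint_inner_left, key, inner_smul_left, inner_e_left]
  simp

theorem shift_unique {w : ℤ → ℂ} {T S : H →L[ℂ] H} (hT : ∀ n, T (e n) = w n • e (n + 1))
    (hS : ∀ n, S (e n) = w n • e (n + 1)) : T = S := by
  ext x n
  obtain ⟨k, rfl⟩ : ∃ k, n = k + 1 := ⟨n - 1, by ring⟩
  rw [shift_apply hT, shift_apply hS]

/-- `A` sends the `n`-th coordinate pair to the `(n + 1)`-st one through the matrix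
`[[p n, r n], [0, q n]]`. -/
structure IsBlockShift_s3 (A : WithLp 2 (H × H) →L[ℂ] WithLp 2 (H × H)) (p r q : ℤ → ℝ) : Prop where
  fst_apply : ∀ x n, (A x).fst (n + 1) = p n * x.fst n + r n * x.snd n
  snd_apply : ∀ x n, (A x).snd (n + 1) = q n * x.snd n

/-- The trace of `Mᴴ * M` for the `n`-th weight `M` of a block shift. -/
def gramTrace (p r q : ℤ → ℝ) (n : ℤ) : ℝ := p n ^ 2 + r n ^ 2 + q n ^ 2

theorem ext_coords {x y : WithLp 2 (H × H)} (h₁ : ∀ n, x.fst n = y.fst n)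
    (h₂ : ∀ n, x.snd n = y.snd n) : x = y := by
  have hfst : x.fst = y.fst := by ext n; exact h₁ n
  have hsnd : x.snd = y.snd := by ext n; exact h₂ n
  exact WithLp.ofLp_injective 2 (Prod.ext hfst hsnd)

/-- The basis vector `(e n, 0)` of `H ⊕ H`. -/
def basisFst (n : ℤ) : WithLp 2 (H × H) := WithLp.toLp 2 (e n, 0)

/-- The basis vector `(0, e n)` of `H ⊕ H`. -/
def basisSnd (n : ℤ) : WithLp 2 (H × H) := WithLp.toLp 2 (0, e n)

theorem inner_basisFst (n : ℤ) (x : WithLp 2 (H × H)) : ⟪basisFst n, x⟫_ℂ = x.fst n := by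
  rw [WithLp.prod_inner_apply]
  simp [-Complex.coe_smul, basisFst, inner_e_left]

theorem inner_basisSnd (n : ℤ) (x : WithLp 2 (H × H)) : ⟪basisSnd n, x⟫_ℂ = x.snd n := by
  rw [WithLp.prod_inner_apply]
  simp [basisSnd, inner_e_left]

namespace IsBlockShift_s3

variable {A : WithLp 2 (H × H) →L[ℂ] WithLp 2 (H × H)} {p r q : ℤ → ℝ}

theorem map_basisFst (hA : IsBlockShift_s3 A p r q) (n : ℤ) :
    A (basisFst n) = (p n : ℂ) • basisFst (n + 1) := by
  refine ext_coords (fun k => ?_) (fun k => ?_) <;>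
    obtain ⟨k, rfl⟩ : ∃ j, k = j + 1 := ⟨k - 1, by ring⟩
  · rw [hA.fst_apply]
    by_cases h : k = n
    · subst h; simp [-Complex.coe_smul, basisFst, e_apply]
    · simp [-Complex.coe_smul, basisFst, e_apply, h]
  · rw [hA.snd_apply]
    simp [-Complex.coe_smul, basisFst]

theorem map_basisSnd (hA : IsBlockShift_s3 A p r q) (n : ℤ) :
    A (basisSnd n) = (r n : ℂ) • basisFst (n + 1) + (q n : ℂ) • basisSnd (n + 1) := by
  refine ext_coords (fun k => ?_) (fun k => ?_) <;>
    obtain ⟨k, rfl⟩ : ∃ j, k = j + 1 := ⟨k - 1, by ring⟩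
  · rw [hA.fst_apply]
    by_cases h : k = n
    · subst h; simp [-Complex.coe_smul, basisFst, basisSnd, e_apply]
    · simp [-Complex.coe_smul, basisFst, basisSnd, e_apply, h]
  · rw [hA.snd_apply]
    by_cases h : k = n
    · subst h; simp [-Complex.coe_smul, basisFst, basisSnd, e_apply]
    · simp [-Complex.coe_smul, basisFst, basisSnd, e_apply, h]

theorem adjoint_fst_apply (hA : IsBlockShift_s3 A p r q) (x : WithLp 2 (H × H)) (n : ℤ) :
    (adjoint A x).fst n = p n * x.fst (n + 1) := by
  rw [← inner_basisFst, adjoint_inner_right, hA.map_basisFst, inner_smul_left, inner_basisFst,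
    Complex.conj_ofReal]

theorem adjoint_snd_apply (hA : IsBlockShift_s3 A p r q) (x : WithLp 2 (H × H)) (n : ℤ) :
    (adjoint A x).snd n = r n * x.fst (n + 1) + q n * x.snd (n + 1) := by
  rw [← inner_basisSnd, adjoint_inner_right, hA.map_basisSnd, inner_add_left, inner_smul_left,
    inner_smul_left, inner_basisFst, inner_basisSnd, Complex.conj_ofReal, Complex.conj_ofReal]

theorem gram_fst_apply (hA : IsBlockShift_s3 A p r q) (x : WithLp 2 (H × H)) (n : ℤ) :
    (adjoint A (A x)).fst n = p n * (p n * x.fst n + r n * x.snd n) := by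
  rw [hA.adjoint_fst_apply, hA.fst_apply]

theorem gram_snd_apply (hA : IsBlockShift_s3 A p r q) (x : WithLp 2 (H × H)) (n : ℤ) :
    (adjoint A (A x)).snd n =
      r n * (p n * x.fst n + r n * x.snd n) + q n * (q n * x.snd n) := by
  rw [hA.adjoint_snd_apply, hA.fst_apply, hA.snd_apply]

/-- Cayley–Hamilton for the unimodular Gram matrices, first coordinate. -/
theorem gram_gram_fst (hA : IsBlockShift_s3 A p r q) (hpq : ∀ n, p n * q n = 1)
    (x : WithLp 2 (H × H)) (n : ℤ) :
    (adjoint A (A (adjoint A (A x)))).fst n + x.fst n =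
      gramTrace p r q n * (adjoint A (A x)).fst n := by
  have h : (p n : ℂ) * q n = 1 := by exact_mod_cast hpq n
  simp only [hA.gram_fst_apply, hA.gram_snd_apply, gramTrace]
  push_cast
  linear_combination (-(x.fst n) * (p n * q n + 1)) * h

/-- Cayley–Hamilton for the unimodular Gram matrices, second coordinate. -/
theorem gram_gram_snd (hA : IsBlockShift_s3 A p r q) (hpq : ∀ n, p n * q n = 1)
    (x : WithLp 2 (H × H)) (n : ℤ) :
    (adjoint A (A (adjoint A (A x)))).snd n + x.snd n =
      gramTrace p r q n * (adjoint A (A x)).snd n := by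
  have h : (p n : ℂ) * q n = 1 := by exact_mod_cast hpq n
  simp only [hA.gram_fst_apply, hA.gram_snd_apply, gramTrace]
  push_cast
  linear_combination (-(x.snd n) * (p n * q n + 1)) * h

theorem gram_gram_basisFst (hA : IsBlockShift_s3 A p r q) (hpq : ∀ n, p n * q n = 1) (n : ℤ) :
    adjoint A (A (adjoint A (A (basisFst n)))) + basisFst n =
      (gramTrace p r q n : ℂ) • adjoint A (A (basisFst n)) := by
  refine ext_coords (fun k => ?_) (fun k => ?_)
  · have := hA.gram_gram_fst hpq (basisFst n) k
    by_cases h : k = n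
    · subst h; simpa [-Complex.coe_smul] using this
    · simp [-Complex.coe_smul, hA.gram_fst_apply, hA.gram_snd_apply, basisFst, e_apply, h]
  · have := hA.gram_gram_snd hpq (basisFst n) k
    by_cases h : k = n
    · subst h; simpa [-Complex.coe_smul] using this
    · simp [-Complex.coe_smul, hA.gram_fst_apply, hA.gram_snd_apply, basisFst, e_apply, h]

/-- If `x` satisfies the quadratic Gram relation with trace `t`, then `t` is the Gram trace at every
index where `x` has a nonzero coordinate. -/
theorem eq_gramTrace (hA : IsBlockShift_s3 A p r q) (hpq : ∀ n, p n * q n = 1)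
    {x : WithLp 2 (H × H)} {t : ℝ}
    (hx : adjoint A (A (adjoint A (A x))) + x = (t : ℂ) • adjoint A (A x)) {m : ℤ}
    (hm : x.fst m ≠ 0 ∨ x.snd m ≠ 0) : t = gramTrace p r q m := by
  have h₁ := hA.gram_gram_fst hpq x m
  have h₂ := hA.gram_gram_snd hpq x m
  have k₁ : (adjoint A (A (adjoint A (A x)))).fst m + x.fst m = t * (adjoint A (A x)).fst m := by
    simpa [-Complex.coe_smul] using congrArg (fun y : WithLp 2 (H × H) => y.fst m) hx
  have k₂ : (adjoint A (A (adjoint A (A x)))).snd m + x.snd m = t * (adjoint A (A x)).snd m := by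
    simpa [-Complex.coe_smul] using congrArg (fun y : WithLp 2 (H × H) => y.snd m) hx
  by_contra hne
  have hne' : (t : ℂ) - gramTrace p r q m ≠ 0 := by
    rw [sub_ne_zero]; exact_mod_cast hne
  have z₁ : (adjoint A (A x)).fst m = 0 := by
    refine (mul_eq_zero.1 ?_).resolve_left hne'
    linear_combination h₁ - k₁
  have z₂ : (adjoint A (A x)).snd m = 0 := by
    refine (mul_eq_zero.1 ?_).resolve_left hne'
    linear_combination h₂ - k₂
  rw [hA.gram_fst_apply, z₁, z₂] at h₁
  rw [hA.gram_snd_apply, z₁, z₂] at h₂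
  rcases hm with hm | hm
  · exact hm (by simpa using h₁)
  · exact hm (by simpa using h₂)

theorem coord_ne_zero (hA : IsBlockShift_s3 A p r q) (hpq : ∀ n, p n * q n = 1)
    {x : WithLp 2 (H × H)} {m : ℤ} (hm : x.fst m ≠ 0 ∨ x.snd m ≠ 0) :
    (A x).fst (m + 1) ≠ 0 ∨ (A x).snd (m + 1) ≠ 0 := by
  by_contra! h
  rw [hA.fst_apply, hA.snd_apply] at h
  have hp : (p m : ℂ) ≠ 0 := by exact_mod_cast left_ne_zero_of_mul_eq_one (hpq m)
  have hq : (q m : ℂ) ≠ 0 := by exact_mod_cast right_ne_zero_of_mul_eq_one (hpq m)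
  have h₂ : x.snd m = 0 := (mul_eq_zero.1 h.2).resolve_left hq
  have h₁ : x.fst m = 0 := by simpa [h₂, hp] using h.1
  exact hm.elim (· h₁) (· h₂)

/-- Unitarily equivalent unimodular block shifts have, up to a shift of the index, the same Gram
traces. -/
theorem exists_gramTrace_eq {B : WithLp 2 (H × H) →L[ℂ] WithLp 2 (H × H)} {p' r' q' : ℤ → ℝ}
    (hA : IsBlockShift_s3 A p r q) (hB : IsBlockShift_s3 B p' r' q') (hpq : ∀ n, p n * q n = 1)
    (hpq' : ∀ n, p' n * q' n = 1) (h : UnitarilyEquiv A B) :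
    ∃ m : ℤ, ∀ n : ℕ, gramTrace p r q n = gramTrace p' r' q' (m + n) := by
  obtain ⟨U, hU⟩ := h
  have hU' : ∀ x, U (adjoint A x) = adjoint B (U x) := by
    intro x
    refine ext_inner_left ℂ fun y => ?_
    obtain ⟨z, rfl⟩ := U.surjective y
    rw [adjoint_inner_right, ← hU, U.inner_map_map, U.inner_map_map, adjoint_inner_right]
  obtain ⟨m, hm⟩ : ∃ m : ℤ, (U (basisFst 0)).fst m ≠ 0 ∨ (U (basisFst 0)).snd m ≠ 0 := by
    by_contra! h
    have h0 : U (basisFst 0) = 0 := ext_coords (fun n => (h n).1) (fun n => (h n).2)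
    have h1 : basisFst 0 = 0 := (LinearIsometryEquiv.map_eq_zero_iff U).1 h0
    have h2 := congrArg (fun y : WithLp 2 (H × H) => y.fst 0) h1
    simp [-Complex.coe_smul, basisFst, e_apply] at h2
  have key : ∀ n : ℕ, (U (basisFst n)).fst (m + n) ≠ 0 ∨ (U (basisFst n)).snd (m + n) ≠ 0 := by
    intro n
    induction n with
    | zero => simpa using hm
    | succ n ih =>
      have h1 := hB.coord_ne_zero hpq' ih
      have hp : (p n : ℂ) ≠ 0 := by exact_mod_cast left_ne_zero_of_mul_eq_one (hpq n)
      rw [← hU, hA.map_basisFst] at h1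
      push_cast
      simpa [-Complex.coe_smul, hp, add_assoc] using h1
  refine ⟨m, fun n => hB.eq_gramTrace hpq' ?_ (key n)⟩
  rw [← hU, ← hU', ← hU, ← hU', ← map_add, hA.gram_gram_basisFst hpq, map_smul]

end IsBlockShift_s3

theorem intCast_add_mul_pos {a b : ℝ} (ha : 0 < a) (ha' : a < 1) (hb : 0 < b) (hb' : b < 1)
    (n : ℤ) : 0 < ((n : ℝ) + a) * (n + b) := by
  rcases le_or_gt 0 n with h | h
  · have : (0 : ℝ) ≤ n := by exact_mod_cast h
    positivity
  · have : (n : ℝ) ≤ -1 := by exact_mod_cast (by lia : n ≤ -1)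
    exact mul_pos_of_neg_of_neg (by linarith) (by linarith)

theorem sqrt_div_mul_sqrt_div {x y : ℝ} (h : 0 < x * y) : √(x / y) * √(y / x) = 1 := by
  have hx : x ≠ 0 := left_ne_zero_of_mul h.ne'
  have hy : y ≠ 0 := right_ne_zero_of_mul h.ne'
  have h' : 0 ≤ x / y := by
    have : x / y = x * y / y ^ 2 := by field_simp
    rw [this]; positivity
  rw [← Real.sqrt_mul h', div_mul_div_cancel₀ hy, div_self hx, Real.sqrt_one]

theorem isBlockShift_blockOp_s3 {a b α : ℝ} {T T' : H →L[ℂ] H}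
    (hT : ∀ n, T (e n) = wT a b n • e (n + 1)) (hT' : ∀ n, T' (e n) = wT b a n • e (n + 1)) :
    IsBlockShift_s3 (blockOp T ((α : ℂ) • (T - T')) T') (fun n => √((n + a) / (n + b)))
      (fun n => α * (√((n + a) / (n + b)) - √((n + b) / (n + a))))
      (fun n => √((n + b) / (n + a))) where
  fst_apply x n := by
    have h : (blockOp T ((α : ℂ) • (T - T')) T' x).fst (n + 1) =
      T x.fst (n + 1) + (α : ℂ) * (T x.snd (n + 1) - T' x.snd (n + 1)) := rfl
    rw [h, shift_apply hT, shift_apply hT, shift_apply hT', wT, wT]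
    push_cast
    ring
  snd_apply x n := shift_apply hT' x.snd n

theorem gramTrace_eq {a b α : ℝ} (ha : 0 < a) (hab : a < b) (hb : b < 1) (n : ℤ) :
    gramTrace (fun n => √((n + a) / (n + b)))
      (fun n => α * (√((n + a) / (n + b)) - √((n + b) / (n + a))))
      (fun n => √((n + b) / (n + a))) n =
    2 + (1 + α ^ 2) * (b - a) ^ 2 / ((n + a) * (n + b)) := by
  have h := intCast_add_mul_pos ha (hab.trans hb) (ha.trans hab) hb n
  have hx : (n : ℝ) + a ≠ 0 := left_ne_zero_of_mul h.ne'
  have hy : (n : ℝ) + b ≠ 0 := right_ne_zero_of_mul h.ne'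
  have h₁ : 0 ≤ ((n : ℝ) + a) / (n + b) := by
    have : ((n : ℝ) + a) / (n + b) = (n + a) * (n + b) / (n + b) ^ 2 := by field_simp
    rw [this]; positivity
  have h₂ : 0 ≤ ((n : ℝ) + b) / (n + a) := by
    have : ((n : ℝ) + b) / (n + a) = (n + a) * (n + b) / (n + a) ^ 2 := by field_simp
    rw [this]; positivity
  have e₁ := Real.sq_sqrt h₁
  have e₂ := Real.sq_sqrt h₂
  have e₃ := sqrt_div_mul_sqrt_div h
  have e₄ : (1 + α ^ 2) * (((n : ℝ) + a) / (n + b) + (n + b) / (n + a)) - 2 * α ^ 2 =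
      2 + (1 + α ^ 2) * (b - a) ^ 2 / ((n + a) * (n + b)) := by
    field_simp
    ring
  rw [← e₄, gramTrace]
  linear_combination (1 + α ^ 2) * e₁ + (1 + α ^ 2) * e₂ - 2 * α ^ 2 * e₃

theorem parameters_eq {a b c d K L : ℝ} (ha : 0 < a) (hab : a < b) (hb : b < 1)
    (hc : 0 < c) (hcd : c < d) (hd : d < 1) (hK : 0 < K) {m : ℤ}
    (h : ∀ n : ℕ, K / (((n : ℤ) + a) * ((n : ℤ) + b)) =
      L / ((((m + n : ℤ) : ℝ) + c) * ((m + n : ℤ) + d))) :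
    a = c ∧ b = d ∧ K = L := by
  have h' : ∀ n : ℕ, K * ((m + n + c) * (m + n + d)) = L * ((n + a) * (n + b)) := by
    intro n
    have h₁ := intCast_add_mul_pos ha (hab.trans hb) (ha.trans hab) hb n
    have h₂ := intCast_add_mul_pos hc (hcd.trans hd) (hc.trans hcd) hd (m + n)
    have := (div_eq_div_iff h₁.ne' h₂.ne').1 (h n)
    push_cast at this
    exact this
  have h0 := h' 0
  have h1 := h' 1
  have h2 := h' 2
  push_cast at h0 h1 h2
  have hKL : K = L := by linear_combination (h0 - 2 * h1 + h2) / 2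
  subst hKL
  have g0 := mul_left_cancel₀ hK.ne' h0
  have g1 := mul_left_cancel₀ hK.ne' h1
  have hs : (m + c) + (m + d) = a + b := by linear_combination g1 - g0
  have hdiff : d - c = b - a := by
    have : (d - c) ^ 2 = (b - a) ^ 2 := by
      linear_combination (2 * m + c + d + a + b) * hs - 4 * g0
    exact (pow_left_inj₀ (by linarith) (by linarith) two_ne_zero).1 this
  have hm : m = 0 := by
    have l₁ : (m : ℝ) < 1 := by linarith
    have l₂ : (-1 : ℝ) < m := by linarith
    have l₁' : m < 1 := by exact_mod_cast l₁
    have l₂' : -1 < m := by exact_mod_cast l₂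
    lia
  subst hm
  push_cast at hs
  exact ⟨by linarith, by linarith, rfl⟩


/-- `T(a₁, b₁, α₁)` and `T(a₂, b₂, α₂)` are unitarily equivalent iff
`a₁ = a₂`, `b₁ = b₂` and `α₁ = α₂`. -/
theorem stmt3 (a₁ b₁ a₂ b₂ : ℝ) (ha₁ : 0 < a₁) (hab₁ : a₁ < b₁) (hb₁ : b₁ < 1)
    (ha₂ : 0 < a₂) (hab₂ : a₂ < b₂) (hb₂ : b₂ < 1)
    (α₁ α₂ : ℝ) (hα₁ : 0 < α₁) (hα₂ : 0 < α₂)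
    (T₁ T₁' T₂ T₂' : H →L[ℂ] H)
    (hT₁ : ∀ n : ℤ, T₁ (e n) = wT a₁ b₁ n • e (n + 1))
    (hT₁' : ∀ n : ℤ, T₁' (e n) = wT b₁ a₁ n • e (n + 1))
    (hT₂ : ∀ n : ℤ, T₂ (e n) = wT a₂ b₂ n • e (n + 1))
    (hT₂' : ∀ n : ℤ, T₂' (e n) = wT b₂ a₂ n • e (n + 1)) :
    UnitarilyEquiv (blockOp T₁ ((α₁ : ℂ) • (T₁ - T₁')) T₁')
        (blockOp T₂ ((α₂ : ℂ) • (T₂ - T₂')) T₂') ↔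
      a₁ = a₂ ∧ b₁ = b₂ ∧ α₁ = α₂ := by
  constructor
  · intro h
    have pq : ∀ {a b : ℝ}, 0 < a → a < b → b < 1 → ∀ n : ℤ,
        √(((n : ℝ) + a) / (n + b)) * √((n + b) / (n + a)) = 1 := fun ha hab hb n =>
      sqrt_div_mul_sqrt_div (intCast_add_mul_pos ha (hab.trans hb) (ha.trans hab) hb n)
    obtain ⟨m, hm⟩ := (isBlockShift_blockOp_s3 hT₁ hT₁').exists_gramTrace_eq
      (isBlockShift_blockOp_s3 hT₂ hT₂') (pq ha₁ hab₁ hb₁) (pq ha₂ hab₂ hb₂) h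
    have hK : 0 < (1 + α₁ ^ 2) * (b₁ - a₁) ^ 2 := by
      have := sub_pos.2 hab₁
      positivity
    obtain ⟨rfl, rfl, hα⟩ := parameters_eq (m := m) ha₁ hab₁ hb₁ ha₂ hab₂ hb₂ hK
      (L := (1 + α₂ ^ 2) * (b₂ - a₂) ^ 2) (fun n => by
        have := hm n
        rwa [gramTrace_eq ha₁ hab₁ hb₁, gramTrace_eq ha₂ hab₂ hb₂, add_right_inj] at this)
    have hne : (b₁ - a₁) ^ 2 ≠ 0 := pow_ne_zero 2 (sub_pos.2 hab₁).ne'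
    have hα' : α₁ ^ 2 = α₂ ^ 2 := add_left_cancel (mul_right_cancel₀ hne hα)
    exact ⟨rfl, rfl, (pow_left_inj₀ hα₁.le hα₂.le two_ne_zero).1 hα'⟩
  · rintro ⟨rfl, rfl, rfl⟩
    rw [shift_unique hT₁ hT₂, shift_unique hT₁' hT₂']
    exact ⟨LinearIsometryEquiv.refl ℂ _, fun _ => rfl⟩
end
end

section
/- For every λ ∈ (−1, 1], every real a > 0 with s = ia, and every α > 0, the operator B(λ, s, α) on ℓ²(ℤ,ℂ) ⊕ ℓ²(ℤ,ℂ) is irreducible: the only closed subspaces of ℓ²(ℤ,ℂ) ⊕ ℓ²(ℤ,ℂ) that are invariant under both B(λ, s, α) and its adjoint are {0} and the whole space. -/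
noncomputable section

open ContinuousLinearMap

open Matrix

theorem weightedShift_apply_succ (w : ℤ → ℂ) (B : H →L[ℂ] H)
    (hB : ∀ n : ℤ, B (e n) = w n • e (n + 1)) (x : H) (m : ℤ) :
    B x (m + 1) = w m * x m := by
  have h := (lp.hasSum_single (E := fun _ : ℤ => ℂ) (p := 2) (by simp) x).mapL
    ((lp.evalCLM ℂ (fun _ : ℤ => ℂ) 2 (m + 1)) ∘L B)
  have hterm : ∀ n : ℤ, ((lp.evalCLM ℂ (fun _ : ℤ => ℂ) 2 (m + 1)) ∘L B)
      (lp.single 2 n (x n)) = if n = m then w m * x m else 0 := by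
    intro n
    have hs : (lp.single 2 n (x n) : H) = x n • e n := by
      rw [e, ← lp.single_smul]; simp
    rw [hs, map_smul, ContinuousLinearMap.comp_apply, hB]
    split_ifs with hnm
    · subst hnm
      simp [e, lp.evalCLM, mul_comm]
    · have : m + 1 ≠ n + 1 := fun h' => hnm (by omega)
      simp [e, lp.evalCLM, Ne.symm hnm]
  simp only [hterm] at h
  exact h.unique (hasSum_ite_eq m (w m * x m))

/-- The standard orthonormal basis vectors of `ℓ²(ℤ, ℂ) ⊕ ℓ²(ℤ, ℂ)`. -/
def basisVec (n : ℤ) (i : Fin 2) : WithLp 2 (H × H) :=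
  WithLp.toLp 2 (![(e n, 0), (0, e n)] i)

/-- The coordinates of a vector of `ℓ²(ℤ, ℂ) ⊕ ℓ²(ℤ, ℂ)`. -/
def coord (n : ℤ) (x : WithLp 2 (H × H)) : Fin 2 → ℂ := ![x.fst n, x.snd n]

theorem inner_basisVec (n : ℤ) (i : Fin 2) (x : WithLp 2 (H × H)) :
    inner ℂ (basisVec n i) x = coord n x i := by
  fin_cases i <;>
    simp [basisVec, coord, WithLp.prod_inner_apply, e, lp.inner_single_left]

theorem ext_coord {x y : WithLp 2 (H × H)} (h : ∀ n, coord n x = coord n y) : x = y := by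
  apply (WithLp.equiv 2 (H × H)).injective
  refine Prod.ext ?_ ?_
  · exact lp.ext (funext fun n => congrFun (h n) 0)
  · exact lp.ext (funext fun n => congrFun (h n) 1)

theorem coord_basisVec_of_ne {m n : ℤ} (h : m ≠ n) (j : Fin 2) :
    coord m (basisVec n j) = 0 := by
  ext i
  fin_cases i <;> fin_cases j <;> simp [coord, basisVec, e, h]

theorem coord_basisVec_self (n : ℤ) (i j : Fin 2) :
    coord n (basisVec n j) i = (1 : Matrix (Fin 2) (Fin 2) ℂ) i j := by
  fin_cases i <;> fin_cases j <;> simp [coord, basisVec, e]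

theorem basisVec_expansion_of_coord {n : ℤ} {x : WithLp 2 (H × H)}
    (h : ∀ m, m ≠ n → coord m x = 0) :
    x = ∑ i, coord n x i • basisVec n i := by
  apply ext_coord
  intro m
  by_cases hm : m = n
  · subst hm
    ext i
    fin_cases i <;> simp [coord, basisVec, e]
  · rw [h m hm]
    ext i
    fin_cases i <;> simp [coord, basisVec, e, hm]

/-- The block of an operator on `ℓ²(ℤ, ℂ) ⊕ ℓ²(ℤ, ℂ)` from position `n` to position `m`. -/
def block (P : WithLp 2 (H × H) →L[ℂ] WithLp 2 (H × H)) (m n : ℤ) : Matrix (Fin 2) (Fin 2) ℂ :=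
  Matrix.of fun i j => coord m (P (basisVec n j)) i

/-- The block of `B(λ, s, α)` attached to a weight `w`. -/
def shiftBlock (α : ℝ) (w : ℂ) : Matrix (Fin 2) (Fin 2) ℂ := !![w, α * (w - 1); 0, 1]

theorem coord_succ_blockOp {w : ℤ → ℂ} {α : ℝ} {B₀ B₁ : H →L[ℂ] H}
    (hB₀ : ∀ n : ℤ, B₀ (e n) = e (n + 1)) (hB₁ : ∀ n : ℤ, B₁ (e n) = w n • e (n + 1))
    (x : WithLp 2 (H × H)) (m : ℤ) :
    coord (m + 1) (blockOp B₁ ((α : ℂ) • (B₁ - B₀)) B₀ x) =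
      shiftBlock α (w m) *ᵥ coord m x := by
  have h₁ := weightedShift_apply_succ w B₁ hB₁
  have h₀ := weightedShift_apply_succ (fun _ => 1) B₀ (by simpa using hB₀)
  ext i
  fin_cases i
  · change B₁ x.fst (m + 1) + α * (B₁ x.snd (m + 1) - B₀ x.snd (m + 1)) = _
    rw [h₁, h₁, h₀]
    simp [coord, shiftBlock]
    ring
  · simp [coord, blockOp, shiftBlock, h₀]

theorem blockOp_basisVec {w : ℤ → ℂ} {α : ℝ} {B₀ B₁ : H →L[ℂ] H}
    (hB₀ : ∀ n : ℤ, B₀ (e n) = e (n + 1)) (hB₁ : ∀ n : ℤ, B₁ (e n) = w n • e (n + 1))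
    (n : ℤ) (j : Fin 2) :
    blockOp B₁ ((α : ℂ) • (B₁ - B₀)) B₀ (basisVec n j) =
      ∑ i, shiftBlock α (w n) i j • basisVec (n + 1) i := by
  have hc := coord_succ_blockOp (α := α) hB₀ hB₁ (basisVec n j)
  refine (basisVec_expansion_of_coord (n := n + 1) fun m hm => ?_).trans ?_
  rotate_left
  · refine Finset.sum_congr rfl fun i _ => ?_
    rw [hc n]
    congr 1
    rw [show coord n (basisVec n j) = (1 : Matrix (Fin 2) (Fin 2) ℂ).col j from
      funext fun i => coord_basisVec_self n i j]
    simp [Matrix.mulVec, dotProduct, Matrix.one_apply]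
  · have := hc (m - 1)
    rw [coord_basisVec_of_ne (by omega), Matrix.mulVec_zero, sub_add_cancel] at this
    exact this

theorem block_intertwines {w : ℤ → ℂ} {α : ℝ} {B₀ B₁ : H →L[ℂ] H}
    (hB₀ : ∀ n : ℤ, B₀ (e n) = e (n + 1)) (hB₁ : ∀ n : ℤ, B₁ (e n) = w n • e (n + 1))
    {P : WithLp 2 (H × H) →L[ℂ] WithLp 2 (H × H)}
    (hP : ∀ x, P (blockOp B₁ ((α : ℂ) • (B₁ - B₀)) B₀ x) =
      blockOp B₁ ((α : ℂ) • (B₁ - B₀)) B₀ (P x)) (m n : ℤ) :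
    block P (m + 1) (n + 1) * shiftBlock α (w n) = shiftBlock α (w m) * block P m n := by
  ext i j
  have h := congrFun (congrArg (coord (m + 1)) (hP (basisVec n j))) i
  rw [coord_succ_blockOp hB₀ hB₁, blockOp_basisVec hB₀ hB₁, ← inner_basisVec, map_sum,
    inner_sum] at h
  simp only [map_smul, inner_smul_right, inner_basisVec] at h
  simpa [Matrix.mul_apply, block, Matrix.mulVec, dotProduct, mul_comm] using h

theorem block_conjTranspose {P : WithLp 2 (H × H) →L[ℂ] WithLp 2 (H × H)}
    (hP : ∀ x y, inner ℂ (P x) y = inner ℂ x (P y)) (m n : ℤ) :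
    (block P m n)ᴴ = block P n m := by
  ext i j
  simp only [block, Matrix.conjTranspose_apply, Matrix.of_apply]
  rw [← inner_basisVec, ← inner_basisVec, ← hP, ← inner_conj_symm, Complex.star_def, Complex.conj_conj]

theorem trace_smul_eq_of_intertwines {D D' K : Matrix (Fin 2) (Fin 2) ℂ}
    (hD : D.det = 1) (hD' : D'.det = 1) (h : K * D = D' * K) :
    D.trace • K = D'.trace • K := by
  have hadj (X : Matrix (Fin 2) (Fin 2) ℂ) : X.trace • (1 : Matrix (Fin 2) (Fin 2) ℂ) =
      X + X.adjugate := by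
    rw [Matrix.adjugate_fin_two, Matrix.trace_fin_two]
    ext i j
    fin_cases i <;> fin_cases j <;> simp [add_comm]
  have h' : K * D.adjugate = D'.adjugate * K := by
    calc K * D.adjugate = D'.adjugate * D' * K * D.adjugate := by
          rw [Matrix.adjugate_mul, hD']; simp
      _ = D'.adjugate * (K * D) * D.adjugate := by rw [h]; simp only [Matrix.mul_assoc]
      _ = D'.adjugate * K := by
          rw [Matrix.mul_assoc, Matrix.mul_assoc, Matrix.mul_adjugate, hD]; simp
  calc D.trace • K = K * (D.trace • 1) := by simp
    _ = (D'.trace • 1) * K := by rw [hadj, hadj, mul_add, add_mul, h, h']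
    _ = D'.trace • K := by simp

theorem shiftBlock_det (α : ℝ) (w : ℂ) : (shiftBlock α w).det = w := by
  simp [shiftBlock, Matrix.det_fin_two]

theorem shiftBlock_trace (α : ℝ) {w : ℂ} (hw : Complex.normSq w = 1) :
    ((shiftBlock α w)ᴴ * shiftBlock α w).trace =
      ((2 + α ^ 2 * Complex.normSq (w - 1) : ℝ) : ℂ) := by
  have h : starRingEnd ℂ w * w = 1 := by rw [← Complex.normSq_eq_conj_mul_self, hw]; simp
  push_cast
  rw [Complex.normSq_eq_conj_mul_self]
  simp [shiftBlock, Matrix.trace_fin_two, Matrix.mul_apply]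
  linear_combination h

theorem sub_I_mul_ne_zero (x : ℝ) {a : ℝ} (ha : a ≠ 0) : (x : ℂ) - Complex.I * a ≠ 0 := by
  intro h
  have := congrArg Complex.im h
  simp at this
  exact ha this

theorem wB_eq (l a : ℝ) (n : ℤ) : wB l a n =
    (((n + (1 + l) / 2 : ℝ) : ℂ) + Complex.I * a) / (((n + (1 + l) / 2 : ℝ) : ℂ) - Complex.I * a) := by
  simp [wB]

theorem normSq_wB (l : ℝ) {a : ℝ} (ha : a ≠ 0) (n : ℤ) : Complex.normSq (wB l a n) = 1 := by
  have : (n + (1 + l) / 2) ^ 2 + a ^ 2 ≠ 0 := by positivity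
  rw [wB_eq, Complex.normSq_div]
  simp only [Complex.normSq_apply, Complex.add_re, Complex.add_im, Complex.sub_re, Complex.sub_im,
    Complex.ofReal_re, Complex.ofReal_im, Complex.mul_re, Complex.mul_im, Complex.I_re,
    Complex.I_im]
  rw [div_eq_one_iff_eq]
  · ring
  · intro h
    exact this (by linear_combination h)

theorem normSq_wB_sub_one (l : ℝ) {a : ℝ} (ha : a ≠ 0) (n : ℤ) :
    Complex.normSq (wB l a n - 1) = 4 * a ^ 2 / ((n + (1 + l) / 2) ^ 2 + a ^ 2) := by
  rw [wB_eq, div_sub_one (sub_I_mul_ne_zero _ ha), Complex.normSq_div]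
  simp only [Complex.normSq_apply, Complex.add_re, Complex.add_im, Complex.sub_re, Complex.sub_im,
    Complex.ofReal_re, Complex.ofReal_im, Complex.mul_re, Complex.mul_im, Complex.I_re,
    Complex.I_im]
  congr 1 <;> ring

theorem wB_ne_one (l : ℝ) {a : ℝ} (ha : a ≠ 0) (n : ℤ) : wB l a n ≠ 1 := by
  intro h
  have := normSq_wB_sub_one l ha n
  rw [h, sub_self, map_zero] at this
  have : 4 * a ^ 2 / ((n + (1 + l) / 2) ^ 2 + a ^ 2) ≠ 0 := by positivity
  exact this (by linarith)

theorem sq_eq_sq_of_trace_eq {l a α : ℝ} (ha : a ≠ 0) (hα : α ≠ 0) {m n : ℤ}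
    (h : ((shiftBlock α (wB l a m))ᴴ * shiftBlock α (wB l a m)).trace =
      ((shiftBlock α (wB l a n))ᴴ * shiftBlock α (wB l a n)).trace) :
    (m + (1 + l) / 2) ^ 2 = (n + (1 + l) / 2) ^ 2 := by
  rw [shiftBlock_trace α (normSq_wB l ha m), shiftBlock_trace α (normSq_wB l ha n),
    Complex.ofReal_inj, normSq_wB_sub_one l ha, normSq_wB_sub_one l ha] at h
  have h' := mul_left_cancel₀ (pow_ne_zero 2 hα) (add_left_cancel h)
  rw [div_eq_div_iff (by positivity) (by positivity)] at h'
  have := mul_left_cancel₀ (by positivity : (4 * a ^ 2 : ℝ) ≠ 0) h'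
  linarith

theorem eq_smul_one_of_commute {u v : ℂ} (hu : u ≠ 0) (hv : v ≠ 0) (huv : u + v ≠ 0)
    {K : Matrix (Fin 2) (Fin 2) ℂ}
    (h₁ : K * !![1, u; star u, 1 + u * star u] = !![1, u; star u, 1 + u * star u] * K)
    (h₂ : K * !![1 + v * star v, v; star v, 1] = !![1 + v * star v, v; star v, 1] * K) :
    K = K 0 0 • 1 := by
  have e₁ := congrFun (congrFun h₁ 0) 0
  have e₂ := congrFun (congrFun h₁ 0) 1
  have e₃ := congrFun (congrFun h₂ 0) 1
  simp [Matrix.mul_apply, Fin.sum_univ_two] at e₁ e₂ e₃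
  have f₂ : K 0 0 - K 1 1 + K 0 1 * star u = 0 := by
    apply mul_left_cancel₀ hu
    rw [mul_zero, Complex.star_def]
    linear_combination e₂
  have f₃ : K 0 0 - K 1 1 - K 0 1 * star v = 0 := by
    apply mul_left_cancel₀ hv
    rw [mul_zero, Complex.star_def]
    linear_combination e₃
  have hs : star (u + v) ≠ 0 := star_ne_zero.mpr huv
  have k01 : K 0 1 = 0 := by
    apply mul_right_cancel₀ hs
    rw [star_add]
    linear_combination f₂ - f₃
  have k10 : K 1 0 = 0 := by
    apply mul_left_cancel₀ hu
    rw [k01] at e₁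
    linear_combination -e₁
  have k11 : K 1 1 = K 0 0 := by
    rw [k01] at f₂
    linear_combination -f₂
  ext i j
  fin_cases i <;> fin_cases j <;> simp [k01, k10, k11]

theorem wB_zero_ne_star_wB_one {l a : ℝ} (hl : -1 < l) (ha : a ≠ 0) :
    wB l a 0 ≠ star (wB l a 1) := by
  have hc := sub_I_mul_ne_zero ((0 : ℤ) + (1 + l) / 2) ha
  have hd := sub_I_mul_ne_zero ((1 : ℤ) + (1 + l) / 2) (neg_ne_zero.mpr ha)
  have hs : star (wB l a 1) =
      ((((1 : ℤ) + (1 + l) / 2 : ℝ) : ℂ) + Complex.I * (-a : ℝ)) /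
        ((((1 : ℤ) + (1 + l) / 2 : ℝ) : ℂ) - Complex.I * (-a : ℝ)) := by
    rw [wB_eq, Complex.star_def, map_div₀, map_sub, map_add, map_mul, Complex.conj_I,
      Complex.conj_ofReal, Complex.conj_ofReal]
    push_cast
    ring
  rw [hs, wB_eq]
  intro h
  rw [div_eq_div_iff hc hd] at h
  have him := congrArg Complex.im h
  simp only [Complex.add_re, Complex.add_im, Complex.sub_re, Complex.sub_im,
    Complex.ofReal_re, Complex.ofReal_im, Complex.mul_re, Complex.mul_im, Complex.I_re,
    Complex.I_im] at him
  have : a * (2 + l) = 0 := by push_cast at him; linarith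
  rcases mul_eq_zero.mp this with h | h
  · exact ha h
  · linarith

theorem conjTranspose_shiftBlock_mul_self (α : ℝ) {w : ℂ} (hw : Complex.normSq w = 1) :
    (shiftBlock α w)ᴴ * shiftBlock α w =
      !![1, α * (1 - star w); star (α * (1 - star w)),
        1 + α * (1 - star w) * star (α * (1 - star w))] := by
  have h : starRingEnd ℂ w * w = 1 := by rw [← Complex.normSq_eq_conj_mul_self, hw]; simp
  ext i j
  fin_cases i <;> fin_cases j <;> simp [shiftBlock, Matrix.mul_apply] <;> grind

theorem shiftBlock_mul_conjTranspose_self (α : ℝ) {w : ℂ} (hw : Complex.normSq w = 1) :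
    shiftBlock α w * (shiftBlock α w)ᴴ =
      !![1 + α * (w - 1) * star (α * (w - 1)), α * (w - 1); star (α * (w - 1)), 1] := by
  have h : starRingEnd ℂ w * w = 1 := by rw [← Complex.normSq_eq_conj_mul_self, hw]; simp
  ext i j
  fin_cases i <;> fin_cases j <;> simp [shiftBlock, Matrix.mul_apply]
  grind

/-- A family of `2 × 2` blocks intertwining the blocks of `B(λ, ia, α)` and their adjoints is
a scalar multiple of the identity. -/
theorem exists_scalar_of_intertwines {l a α : ℝ} (hl : -1 < l) (ha : a ≠ 0) (hα : α ≠ 0)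
    {K : ℤ → ℤ → Matrix (Fin 2) (Fin 2) ℂ}
    (hK : ∀ m n, K (m + 1) (n + 1) * shiftBlock α (wB l a n) = shiftBlock α (wB l a m) * K m n)
    (hK' : ∀ m n, (K m n)ᴴ = K n m) :
    ∃ p : ℂ, (∀ n, K n n = p • 1) ∧ ∀ m n, m ≠ n → K m n = 0 := by
  set A : ℤ → Matrix (Fin 2) (Fin 2) ℂ := fun n => shiftBlock α (wB l a n) with hA
  have hstar (m n : ℤ) : (A m)ᴴ * K (m + 1) (n + 1) = K m n * (A n)ᴴ := by
    have := congrArg Matrix.conjTranspose (hK n m)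
    rwa [Matrix.conjTranspose_mul, Matrix.conjTranspose_mul, hK', hK'] at this
  have hD (m n : ℤ) : K m n * ((A n)ᴴ * A n) = (A m)ᴴ * A m * K m n := by
    rw [← Matrix.mul_assoc, ← hstar, Matrix.mul_assoc, hK, Matrix.mul_assoc]
  have hE (m n : ℤ) : K (m + 1) (n + 1) * (A n * (A n)ᴴ) = A m * (A m)ᴴ * K (m + 1) (n + 1) := by
    rw [← Matrix.mul_assoc, hK, Matrix.mul_assoc, ← hstar, Matrix.mul_assoc]
  have hdet (n : ℤ) : ((A n)ᴴ * A n).det = 1 := by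
    rw [Matrix.det_mul, Matrix.det_conjTranspose, shiftBlock_det, Complex.star_def,
      ← Complex.normSq_eq_conj_mul_self, normSq_wB l ha, Complex.ofReal_one]
  have hdet' (n : ℤ) : (A n * (A n)ᴴ).det = 1 := by
    rw [Matrix.det_mul, mul_comm, ← Matrix.det_mul, hdet]
  have hunit (n : ℤ) : IsUnit (A n) := by
    rw [Matrix.isUnit_iff_isUnit_det, shiftBlock_det, isUnit_iff_ne_zero]
    intro h
    have := normSq_wB l ha n
    simp [h] at this
  have hoff (m n : ℤ) (hmn : m ≠ n) : K m n = 0 := by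
    by_contra hne
    have t₁ := sq_eq_sq_of_trace_eq ha hα
      (smul_left_injective ℂ hne (trace_smul_eq_of_intertwines (hdet n) (hdet m) (hD m n)))
    have hE' := hE (m - 1) (n - 1)
    rw [sub_add_cancel, sub_add_cancel] at hE'
    have t₂ := smul_left_injective ℂ hne
      (trace_smul_eq_of_intertwines (hdet' (n - 1)) (hdet' (m - 1)) hE')
    rw [Matrix.trace_mul_comm, Matrix.trace_mul_comm (A (m - 1))] at t₂
    have t₂ := sq_eq_sq_of_trace_eq ha hα t₂
    push_cast at t₂
    exact hmn (by exact_mod_cast (by linarith : (m : ℝ) = n))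
  have hbase : K 1 1 = K 1 1 0 0 • 1 := by
    have h₁ := hD 1 1
    have h₂ := hE 0 0
    rw [conjTranspose_shiftBlock_mul_self α (normSq_wB l ha 1)] at h₁
    rw [zero_add, shiftBlock_mul_conjTranspose_self α (normSq_wB l ha 0)] at h₂
    have hαc : (α : ℂ) ≠ 0 := Complex.ofReal_ne_zero.mpr hα
    refine eq_smul_one_of_commute (mul_ne_zero hαc ?_)
      (mul_ne_zero hαc (sub_ne_zero.mpr (wB_ne_one l ha 0))) ?_ h₁ h₂
    · rw [sub_ne_zero, ne_comm, Ne, star_eq_iff_star_eq, star_one, eq_comm]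
      exact wB_ne_one l ha 1
    · rw [← mul_add, add_comm, sub_add_sub_cancel]
      exact mul_ne_zero hαc (sub_ne_zero.mpr (wB_zero_ne_star_wB_one hl ha))
  refine ⟨K 1 1 0 0, fun n => ?_, hoff⟩
  induction n using Int.inductionOn' (b := 1) with
  | zero => exact hbase
  | succ k _ ih =>
    have h := hK k k
    rw [ih, Matrix.mul_smul, mul_one] at h
    exact (hunit k).mul_right_cancel (h.trans (by rw [smul_mul_assoc, one_mul]))
  | pred k _ ih =>
    have h := hK (k - 1) (k - 1)
    rw [sub_add_cancel, ih, smul_mul_assoc, one_mul] at h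
    exact (hunit (k - 1)).mul_left_cancel (h.symm.trans (by rw [Matrix.mul_smul, mul_one]))

theorem starProjection_commute_of_reducing {E : Type*} [NormedAddCommGroup E]
    [InnerProductSpace ℂ E] [CompleteSpace E] {T : E →L[ℂ] E} {M : Submodule ℂ E}
    [M.HasOrthogonalProjection] (h : ∀ x ∈ M, T x ∈ M) (h' : ∀ x ∈ M, adjoint T x ∈ M) (x : E) :
    M.starProjection (T x) = T (M.starProjection x) := by
  refine (Submodule.eq_starProjection_of_mem_of_inner_eq_zero
    (h _ (M.starProjection_apply_mem x)) fun y hy => ?_)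
  rw [← map_sub, ← adjoint_inner_right]
  exact M.starProjection_inner_eq_zero x _ (h' y hy)

/-- the operator `B(λ, ia, α)` is irreducible. -/
theorem stmt7 (l a α : ℝ) (hl : -1 < l ∧ l ≤ 1) (ha : 0 < a) (hα : 0 < α)
    (B₀ B₁ : H →L[ℂ] H)
    (hB₀ : ∀ n : ℤ, B₀ (e n) = e (n + 1))
    (hB₁ : ∀ n : ℤ, B₁ (e n) = wB l a n • e (n + 1)) :
    IrreducibleOp (blockOp B₁ ((α : ℂ) • (B₁ - B₀)) B₀) := by
  intro M hM hT hT'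
  have : CompleteSpace M := hM.completeSpace_coe
  set P := M.starProjection with hPdef
  have hsymm (x y) : inner ℂ (P x) y = inner ℂ x (P y) := M.inner_starProjection_left_eq_right x y
  obtain ⟨p, hdiag, hoff⟩ := exists_scalar_of_intertwines (K := block P) hl.1 ha.ne' hα.ne'
    (block_intertwines hB₀ hB₁ (starProjection_commute_of_reducing hT hT'))
    (block_conjTranspose hsymm)
  have hbasis (n : ℤ) (j : Fin 2) : P (basisVec n j) = p • basisVec n j := by
    apply ext_coord
    intro m
    ext i
    rw [← inner_basisVec, ← inner_basisVec, inner_smul_right, inner_basisVec, inner_basisVec]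
    change block P m n i j = _
    by_cases hmn : m = n
    · subst hmn
      rw [hdiag, coord_basisVec_self]
      rfl
    · rw [hoff m n hmn, coord_basisVec_of_ne hmn]
      simp
  have hscalar (x) : P x = star p • x := by
    apply ext_coord
    intro n
    ext i
    rw [← inner_basisVec, ← hsymm, hbasis, inner_smul_left, ← inner_basisVec, inner_smul_right]
    rfl
  by_cases hbot : M = ⊥
  · exact Or.inl hbot
  · right
    obtain ⟨x, hx, hx0⟩ := M.exists_mem_ne_zero_of_ne_bot hbot
    have hp : star p = 1 := by
      have h1 : P x = x := Submodule.starProjection_eq_self_iff.mpr hx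
      rw [hscalar] at h1
      exact smul_left_injective ℂ hx0 (h1.trans (one_smul ℂ x).symm)
    refine Submodule.eq_top_iff'.mpr fun y => ?_
    rw [← Submodule.starProjection_eq_self_iff]
    exact (hscalar y).trans (by rw [hp, one_smul])
end
end
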